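/- Let L be an n×n real Laplacian matrix with eigenprojection L^⊢ at eigenvalue 0. Then L^⊢ is a row-stochastic matrix: all entries of L^⊢ are nonnegative and every row sum of L^⊢ equals 1; in particular L^⊢ 𝟏 = 𝟏, and moreover L L^⊢ = L^⊢ L = 0. -/

import Mathlib

open Matrix Filter Topology

/-- `L` is the Laplacian matrix of a weighted digraph: off-diagonal entries are
nonpositive and every row sum is zero. -/
def IsLaplacian {m : Type*} [Fintype m] [DecidableEq m] (L : Matrix m m ℝ) : Prop :=
  (∀ i j, i ≠ j → L i j ≤ 0) ∧ (∀ i, ∑ j, L i j = 0)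

/-- `P` is the eigenprojection of the square matrix `M` at eigenvalue `0`:
`P` is idempotent, its range is the kernel of `M ^ k` and its kernel is the range
of `M ^ k`, where `k` is the size of the matrix. -/
def IsEigenprojection {m : Type*} [Fintype m] [DecidableEq m] (M P : Matrix m m ℝ) : Prop :=
  P * P = P ∧
  LinearMap.range P.mulVecLin = LinearMap.ker (M ^ Fintype.card m).mulVecLin ∧
  LinearMap.ker P.mulVecLin = LinearMap.range (M ^ Fintype.card m).mulVecLin

theorem nonneg_of_forall_pos_add_mul_nonneg {a b : ℝ} (h : ∀ ε > 0, 0 ≤ a + ε * b) : 0 ≤ a := by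
  by_contra! ha
  have hb : 0 < |b| + 1 := by positivity
  have hε : 0 < -a / (|b| + 1) := div_pos (by linarith) hb
  have h1 := h _ hε
  have h2 : -a / (|b| + 1) * (|b| + 1) = -a := div_mul_cancel₀ _ hb.ne'
  nlinarith [mul_le_mul_of_nonneg_left (le_abs_self b) hε.le]

namespace IsLaplacian

variable {m : Type*} [Fintype m] [DecidableEq m] {L : Matrix m m ℝ}

theorem mulVec_one (hL : IsLaplacian L) : L *ᵥ (1 : m → ℝ) = 0 := by
  ext i
  simpa [mulVec, dotProduct] using hL.2 i

/-- A Laplacian matrix is nonpositive at a minimum. -/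
theorem mulVec_apply_nonpos (hL : IsLaplacian L) {x : m → ℝ} {i : m} (hi : ∀ j, x i ≤ x j) :
    (L *ᵥ x) i ≤ 0 := by
  have h : (L *ᵥ x) i = ∑ j, L i j * (x j - x i) := by
    simp [mulVec, dotProduct, mul_sub, Finset.sum_sub_distrib, ← Finset.sum_mul, hL.2 i]
  rw [h]
  refine Finset.sum_nonpos fun j _ => ?_
  by_cases hij : i = j
  · simp [hij]
  · exact mul_nonpos_of_nonpos_of_nonneg (hL.1 i j hij) (sub_nonneg.2 (hi j))

/-- Minimum principle for the resolvent of a Laplacian matrix. -/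
theorem le_of_le_smul_add_mulVec (hL : IsLaplacian L) {x : m → ℝ} {ε c : ℝ} (hε : 0 < ε)
    (h : ∀ i, ε * c ≤ (ε • x + L *ᵥ x) i) (i : m) : c ≤ x i := by
  have : Nonempty m := ⟨i⟩
  obtain ⟨k, hk⟩ := Finite.exists_min x
  have h1 := h k
  have h2 := hL.mulVec_apply_nonpos hk
  simp only [Pi.add_apply, Pi.smul_apply, smul_eq_mul] at h1
  exact (le_of_mul_le_mul_left (by linarith) hε).trans (hk i)

theorem mulVec_apply_nonpos_of_mulVec_mulVec_eq_zero (hL : IsLaplacian L) {x : m → ℝ}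
    (h : L *ᵥ (L *ᵥ x) = 0) (i : m) : (L *ᵥ x) i ≤ 0 := by
  suffices 0 ≤ -(L *ᵥ x) i by linarith
  refine nonneg_of_forall_pos_add_mul_nonneg (b := x i + ‖x‖) fun ε hε => ?_
  have key := hL.le_of_le_smul_add_mulVec (x := ε • x - L *ᵥ x) (c := -(ε * ‖x‖)) hε
    (fun j => by
      have hj := (abs_le.1 (norm_le_pi_norm x j)).1
      simp only [mulVec_sub, mulVec_smul, h, Pi.add_apply, Pi.sub_apply, Pi.smul_apply,
        smul_eq_mul, Pi.zero_apply]
      nlinarith [mul_le_mul_of_nonneg_left hj (mul_pos hε hε).le]) i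
  simp only [Pi.sub_apply, Pi.smul_apply, smul_eq_mul] at key
  linarith

/-- The eigenvalue `0` of a Laplacian matrix is semisimple. -/
theorem mulVec_eq_zero_of_mulVec_mulVec_eq_zero (hL : IsLaplacian L) {x : m → ℝ}
    (h : L *ᵥ (L *ᵥ x) = 0) : L *ᵥ x = 0 := by
  ext i
  have h1 := hL.mulVec_apply_nonpos_of_mulVec_mulVec_eq_zero h i
  have h2 := hL.mulVec_apply_nonpos_of_mulVec_mulVec_eq_zero (x := -x)
    (by simp [mulVec_neg, h]) i
  simp only [mulVec_neg, Pi.neg_apply] at h2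
  exact le_antisymm h1 (by simpa using h2)

theorem mulVec_eq_zero_of_pow_mulVec_eq_zero (hL : IsLaplacian L) {x : m → ℝ} (k : ℕ)
    (h : (L ^ k) *ᵥ x = 0) : L *ᵥ x = 0 := by
  induction k generalizing x with
  | zero => simp_all
  | succ k ih =>
    rw [pow_succ, ← mulVec_mulVec] at h
    exact hL.mulVec_eq_zero_of_mulVec_mulVec_eq_zero (ih h)

/-- If `y` splits as `p + L z` with `p` in the kernel of `L`, then `p` is nonnegative
whenever `y` is. -/
theorem kernel_component_nonneg (hL : IsLaplacian L) {y p z : m → ℝ} (hy : ∀ i, 0 ≤ y i)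
    (hp : L *ᵥ p = 0) (h : y = p + L *ᵥ z) (i : m) : 0 ≤ p i := by
  refine nonneg_of_forall_pos_add_mul_nonneg (b := z i + ‖z‖) fun ε hε => ?_
  have key := hL.le_of_le_smul_add_mulVec (x := p + ε • z) (c := -(ε * ‖z‖)) hε
    (fun j => by
      have hj := (abs_le.1 (norm_le_pi_norm z j)).1
      have hyj := hy j
      rw [h] at hyj
      simp only [mulVec_add, mulVec_smul, hp, Pi.add_apply, Pi.smul_apply,
        smul_eq_mul, Pi.zero_apply] at hyj ⊢
      nlinarith [mul_le_mul_of_nonneg_left hj (mul_pos hε hε).le, mul_nonneg hε.le hyj]) i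
  simp only [Pi.add_apply, Pi.smul_apply, smul_eq_mul] at key
  linarith

end IsLaplacian

namespace IsEigenprojection

variable {m : Type*} [Fintype m] [DecidableEq m] {M P : Matrix m m ℝ}

theorem pow_mulVec_mulVec (hP : IsEigenprojection M P) (x : m → ℝ) :
    (M ^ Fintype.card m) *ᵥ (P *ᵥ x) = 0 := by
  have h : P *ᵥ x ∈ LinearMap.range P.mulVecLin := ⟨x, rfl⟩
  rw [hP.2.1] at h
  exact h

theorem mulVec_eq_self (hP : IsEigenprojection M P) {x : m → ℝ}
    (hx : (M ^ Fintype.card m) *ᵥ x = 0) : P *ᵥ x = x := by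
  have h : x ∈ LinearMap.range P.mulVecLin := by
    rw [hP.2.1]
    exact hx
  obtain ⟨y, rfl⟩ := h
  simp [hP.1]

theorem exists_eq_mulVec_add_mulVec [Nonempty m] (hP : IsEigenprojection M P) (y : m → ℝ) :
    ∃ z, y = P *ᵥ y + M *ᵥ z := by
  have h : y - P *ᵥ y ∈ LinearMap.ker P.mulVecLin := by
    simp [mulVec_sub, hP.1]
  rw [hP.2.2] at h
  obtain ⟨w, hw⟩ := h
  obtain ⟨k, hk⟩ := Nat.exists_eq_succ_of_ne_zero (Fintype.card_ne_zero (α := m))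
  refine ⟨(M ^ k) *ᵥ w, ?_⟩
  rw [mulVecLin_apply, hk, Nat.succ_eq_add_one, pow_succ', ← mulVec_mulVec] at hw
  rw [hw, add_sub_cancel]

end IsEigenprojection

/-- The eigenprojection of a Laplacian matrix is row stochastic, fixes the
all-ones vector, and annihilates `L` on both sides. -/
theorem eigenprojection_row_stochastic {n : ℕ} (L P : Matrix (Fin n) (Fin n) ℝ)
    (hL : IsLaplacian L) (hP : IsEigenprojection L P) :
    (∀ i j, 0 ≤ P i j) ∧ (∀ i, ∑ j, P i j = 1) ∧
    P *ᵥ (1 : Fin n → ℝ) = 1 ∧ L * P = 0 ∧ P * L = 0 := by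
  rcases isEmpty_or_nonempty (Fin n) with _ | _
  · exact ⟨isEmptyElim, isEmptyElim, Subsingleton.elim _ _, Subsingleton.elim _ _,
      Subsingleton.elim _ _⟩
  have hLP (x : Fin n → ℝ) : L *ᵥ (P *ᵥ x) = 0 :=
    hL.mulVec_eq_zero_of_pow_mulVec_eq_zero _ (hP.pow_mulVec_mulVec x)
  have hPL (x : Fin n → ℝ) : P *ᵥ (L *ᵥ x) = 0 := by
    obtain ⟨z, hz⟩ := hP.exists_eq_mulVec_add_mulVec (L *ᵥ x)
    have h : P *ᵥ (L *ᵥ x) = L *ᵥ (x - z) := by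
      rw [mulVec_sub, eq_sub_iff_add_eq, ← hz]
    rw [h]
    apply hL.mulVec_eq_zero_of_mulVec_mulVec_eq_zero
    rw [← h, hLP]
  have hone : P *ᵥ (1 : Fin n → ℝ) = 1 := by
    apply hP.mulVec_eq_self
    obtain ⟨k, hk⟩ := Nat.exists_eq_succ_of_ne_zero (Fintype.card_ne_zero (α := Fin n))
    rw [hk, Nat.succ_eq_add_one, pow_succ, ← mulVec_mulVec, hL.mulVec_one, mulVec_zero]
  refine ⟨fun i j => ?_, fun i => ?_, hone, ?_, ?_⟩
  · obtain ⟨z, hz⟩ := hP.exists_eq_mulVec_add_mulVec (Pi.single j 1)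
    have hy (k : Fin n) : (0 : ℝ) ≤ (Pi.single j 1 : Fin n → ℝ) k :=
      by simp only [Pi.single_apply]; split_ifs <;> norm_num
    simpa using hL.kernel_component_nonneg hy (hLP _) hz i
  · simpa [mulVec, dotProduct] using congrFun hone i
  · exact ext_of_mulVec_single fun j => by rw [← mulVec_mulVec, hLP, zero_mulVec]
  · exact ext_of_mulVec_single fun j => by rw [← mulVec_mulVec, hPL, zero_mulVec]
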